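/- Let k, ℓ be integers with k ≥ 1 and 0 ≤ ℓ ≤ 2k−1, Γ a group, and α: 2^Γ → {0,1,…,ℓ} a normalized polymatroidal function satisfying the smoothness condition. Suppose the Γ-labeled graph (G,ψ) is α-critical and f_α-full, and let v be the base for the near-balancedness. If E₁ and E₂ are two distinct extra edge sets for the near-balancedness, then {E₁ ∖ L_v, E₂ ∖ L_v} is a partition of E_v ∖ L_v, where E_v is the set of edges incident to v and L_v the set of loops at v. -/

import Mathlib

/- Formalization of count matroids of group-labeled graphs. -/

namespace CountMatroidPaper

attribute [local instance] Classical.propDecidable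

/-- A `Γ`-labeled graph: a directed multigraph with edge set `E`, vertex set `V`,
and a gain (group label) on each edge. -/
structure GainGraph (V E Γ : Type*) where
  tail : E → V
  head : E → V
  gain : E → Γ

variable {V E Γ : Type*}

namespace GainGraph

variable [Group Γ]

/-- `V(F)`: the set of vertices incident to the edge set `F`. -/
def verts [DecidableEq V] (G : GainGraph V E Γ) (F : Finset E) : Finset V :=
  F.image G.tail ∪ F.image G.head

/-- `G.GainWalk F u w g` : there is a walk from `u` to `w` using edges of `F` whose gain is `g`. -/
inductive GainWalk (G : GainGraph V E Γ) (F : Set E) (u : V) : V → Γ → Prop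
  | nil : GainWalk G F u u 1
  | fwd {w : V} {g : Γ} {e : E} : GainWalk G F u w g → e ∈ F → G.tail e = w →
      GainWalk G F u (G.head e) (g * G.gain e)
  | bwd {w : V} {g : Γ} {e : E} : GainWalk G F u w g → e ∈ F → G.head e = w →
      GainWalk G F u (G.tail e) (g * (G.gain e)⁻¹)

/-- An edge set is balanced if every closed walk in it has identity gain. -/
def Balanced (G : GainGraph V E Γ) (F : Set E) : Prop :=
  ∀ (v : V) (g : Γ), G.GainWalk F v v g → g = 1

/-- Membership in `C(G)` : a nonempty edge set `F` such that `(V(F), F)` is connected. -/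
def Connected [DecidableEq V] (G : GainGraph V E Γ) (F : Finset E) : Prop :=
  F.Nonempty ∧ ∀ u ∈ G.verts F, ∀ w ∈ G.verts F, ∃ g : Γ, G.GainWalk (↑F) u w g

/-- The set of gains of closed walks based at `v` using edges of `F`. -/
def gains (G : GainGraph V E Γ) (F : Set E) (v : V) : Set Γ :=
  {g | G.GainWalk F v v g}

/-- `α̃(F)`: the value of `α` on (a generating set of) the subgroup `⟨F⟩_{v,ψ}` for a
vertex `v ∈ V(F)`.  For a polymatroidal `α` (invariant under conjugation and under taking
generated subgroups) this is independent of the choice of `v`. -/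
noncomputable def alphaTilde (α : Set Γ → ℤ) (G : GainGraph V E Γ) (F : Finset E) : ℤ :=
  if h : F.Nonempty then α (G.gains (↑F) (G.tail h.choose)) else 0

/-- Loops at `v`. -/
def loopsAt (G : GainGraph V E Γ) (v : V) : Set E :=
  {e | G.tail e = v ∧ G.head e = v}

/-- Unbalanced (non-identity labeled) loops at `v`, i.e. `L_v \ L_v°`. -/
def unbalancedLoopsAt (G : GainGraph V E Γ) (v : V) : Set E :=
  {e | G.tail e = v ∧ G.head e = v ∧ G.gain e ≠ 1}

/-- `E_v`: edges incident to `v`. -/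
def incidentAt (G : GainGraph V E Γ) (v : V) : Set E :=
  {e | G.tail e = v ∨ G.head e = v}

/-- Non-loop edges incident to `v`. -/
def nonloopAt (G : GainGraph V E Γ) (v : V) : Set E :=
  {e | (G.tail e = v ∨ G.head e = v) ∧ G.tail e ≠ G.head e}

/-- The split of `(G,ψ)` at `v` with respect to the bipartition `{E₁, E₂}` of the non-loop
edges incident to `v`, where `B = E₂`: the vertex `v` is split into `v₁ = Sum.inl v` and
`v₂ = Sum.inr ()`; edges in `B` become incident to `v₂`, the remaining non-loop edges at `v`
to `v₁`; balanced loops at `v` stay loops at `v₁`, and unbalanced loops at `v` become arcs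
from `v₁` to `v₂`, keeping the labeling. -/
noncomputable def split (G : GainGraph V E Γ) (v : V) (B : Set E) :
    GainGraph (V ⊕ Unit) E Γ where
  tail e :=
    if G.tail e = v ∧ G.head e = v then Sum.inl v
    else if G.tail e = v ∧ e ∈ B then Sum.inr ()
    else Sum.inl (G.tail e)
  head e :=
    if G.tail e = v ∧ G.head e = v then
      (if G.gain e = 1 then Sum.inl v else Sum.inr ())
    else if G.head e = v ∧ e ∈ B then Sum.inr ()
    else Sum.inl (G.head e)
  gain := G.gain

/-- `v` is a base for the near-balancedness of `F`, witnessed by the part `B` of the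
bipartition of the non-loop edges at `v`: the corresponding split makes `F` balanced. -/
def IsSplitBase (G : GainGraph V E Γ) (F : Finset E) (v : V) (B : Set E) : Prop :=
  B ⊆ G.nonloopAt v ∧ Balanced (G.split v B) (↑F)

/-- A connected edge set is near-balanced if it is unbalanced and some split of `(G,ψ)`
makes it balanced. -/
def NearBalanced (G : GainGraph V E Γ) (F : Finset E) : Prop :=
  ¬ G.Balanced (↑F) ∧ ∃ (v : V) (B : Set E), G.IsSplitBase F v B

/-- `K` is an extra edge set for the near-balancedness of `F` with base `v`:
`K = E₂ ∪ (L_v \ L_v°)` (or `E₁ ∪ (L_v \ L_v°)`) for a balanced split at `v` with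
bipartition `{E₁, E₂}`. -/
def ExtraEdgeSet (G : GainGraph V E Γ) (F : Finset E) (v : V) (K : Set E) : Prop :=
  ∃ B : Set E, G.IsSplitBase F v B ∧
    (K = B ∪ G.unbalancedLoopsAt v ∨
     K = (G.nonloopAt v \ B) ∪ G.unbalancedLoopsAt v)

/-- `β(F)`. -/
noncomputable def beta (α : Set Γ → ℤ) (k : ℤ) [DecidableEq V]
    (G : GainGraph V E Γ) (F : Finset E) : ℤ :=
  if G.NearBalanced F then min (alphaTilde α G F) k else alphaTilde α G F

/-- `f_α(F) = k|V(F)| - ℓ + β(F)`. -/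
noncomputable def fAlpha (α : Set Γ → ℤ) (k ℓ : ℤ) [DecidableEq V]
    (G : GainGraph V E Γ) (F : Finset E) : ℤ :=
  k * ((G.verts F).card : ℤ) - ℓ + beta α k G F

/-- `I` is `f_α`-sparse: `|F| ≤ f_α(F)` for every `F ∈ C(G)` with `F ⊆ I`. -/
def Sparse (α : Set Γ → ℤ) (k ℓ : ℤ) [DecidableEq V]
    (G : GainGraph V E Γ) (I : Finset E) : Prop :=
  ∀ F : Finset E, F ⊆ I → G.Connected F → (F.card : ℤ) ≤ fAlpha α k ℓ G F

/-- `F` is `f_α`-tight: connected, `f_α`-sparse, with `|F| = f_α(F)`. -/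
def Tight (α : Set Γ → ℤ) (k ℓ : ℤ) [DecidableEq V]
    (G : GainGraph V E Γ) (F : Finset E) : Prop :=
  G.Connected F ∧ Sparse α k ℓ G F ∧ (F.card : ℤ) = fAlpha α k ℓ G F

/-- An edge set `Y` is `f_α`-full: the subgraph `(V(Y), Y)` contains a spanning connected
`f_α`-sparse subgraph `G'` with `β(E(G')) = β(Y)` and
`|E(G')| ≥ k|V(G')| - ℓ + min{β(E(G')), 2k - ℓ + 1}`. -/
def Full (α : Set Γ → ℤ) (k ℓ : ℤ) [DecidableEq V]
    (G : GainGraph V E Γ) (Y : Finset E) : Prop :=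
  ∃ E' : Finset E, E' ⊆ Y ∧ G.Connected E' ∧ G.verts E' = G.verts Y ∧
    Sparse α k ℓ G E' ∧ beta α k G E' = beta α k G Y ∧
    k * ((G.verts E').card : ℤ) - ℓ + min (beta α k G E') (2 * k - ℓ + 1) ≤ (E'.card : ℤ)

/-- The graph `(G,ψ)` is `f_α`-full: it contains a spanning connected `f_α`-sparse
subgraph `G'` with `β(E(G')) = β(E(G))` and
`|E(G')| ≥ k|V(G')| - ℓ + min{β(E(G')), 2k - ℓ + 1}`. -/
def FullGraph [Fintype V] [Fintype E] [DecidableEq V]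
    (α : Set Γ → ℤ) (k ℓ : ℤ) (G : GainGraph V E Γ) : Prop :=
  ∃ E' : Finset E, G.Connected E' ∧ G.verts E' = Finset.univ ∧
    Sparse α k ℓ G E' ∧ beta α k G E' = beta α k G (Finset.univ : Finset E) ∧
    k * ((G.verts E').card : ℤ) - ℓ + min (beta α k G E') (2 * k - ℓ + 1) ≤ (E'.card : ℤ)

/-- `F` is `α`-critical: connected, near-balanced, and `α̃(F) > k`. -/
def AlphaCritical (α : Set Γ → ℤ) (k : ℤ) [DecidableEq V]
    (G : GainGraph V E Γ) (F : Finset E) : Prop :=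
  G.Connected F ∧ G.NearBalanced F ∧ k < alphaTilde α G F

/-- Switching at `v` with `g`. -/
noncomputable def switch (G : GainGraph V E Γ) (v : V) (g : Γ) : GainGraph V E Γ where
  tail := G.tail
  head := G.head
  gain e :=
    if G.tail e = v ∧ G.head e = v then g * G.gain e * g⁻¹
    else if G.tail e = v then g * G.gain e
    else if G.head e = v then G.gain e * g⁻¹
    else G.gain e

/-- Two gain functions (on the same underlying graph) are equivalent if one is obtained
from the other by a sequence of switchings. -/
def Equivalent (G G' : GainGraph V E Γ) : Prop :=
  Relation.ReflTransGen (fun H H' : GainGraph V E Γ => ∃ (v : V) (g : Γ), H' = H.switch v g) G G'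

/-- The label of the edge `e`, re-oriented so that `e` is directed towards `v`. -/
noncomputable def orientTo (G : GainGraph V E Γ) (v : V) (e : E) : Γ :=
  if G.head e = v then G.gain e else (G.gain e)⁻¹

/-- Adjacency in `G - v`. -/
def AdjAvoid (G : GainGraph V E Γ) (v u w : V) : Prop :=
  u ≠ v ∧ w ≠ v ∧ ∃ e : E, (G.tail e = u ∧ G.head e = w) ∨ (G.tail e = w ∧ G.head e = u)

/-- `S` is (the edge set of) a fraction of `v`: the subgraph of `G - L_v` induced by `v`
together with the vertex set of a connected component of `G - v`. -/
def IsFraction [Fintype E] (G : GainGraph V E Γ) (v : V) (S : Finset E) : Prop :=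
  ∃ u : V, u ≠ v ∧
    S = Finset.univ.filter (fun e =>
      ¬ (G.tail e = v ∧ G.head e = v) ∧
      (G.tail e = v ∨ Relation.ReflTransGen (G.AdjAvoid v) u (G.tail e)) ∧
      (G.head e = v ∨ Relation.ReflTransGen (G.AdjAvoid v) u (G.head e)))

/-- `I` is `(k,m)`-sparse: `|F| ≤ k|V(F)| - m` for every nonempty `F ⊆ I`. -/
def CountSparse [DecidableEq V] (G : GainGraph V E Γ) (k m : ℤ) (I : Finset E) : Prop :=
  ∀ F : Finset E, F ⊆ I → F.Nonempty → (F.card : ℤ) ≤ k * ((G.verts F).card : ℤ) - m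

/-- `C` is a circuit of the `(k,m)`-count matroid `M_{k,m}(G)`: a minimal set that is
not `(k,m)`-sparse. -/
def CountCircuit [DecidableEq V] (G : GainGraph V E Γ) (k m : ℤ) (C : Finset E) : Prop :=
  ¬ G.CountSparse k m C ∧ ∀ C' : Finset E, C' ⊆ C → C' ≠ C → G.CountSparse k m C'

end GainGraph

/-- `α : 2^Γ → ℤ` is polymatroidal. -/
structure Polymatroidal [Group Γ] (α : Set Γ → ℤ) : Prop where
  empty : α ∅ = 0
  submodular : ∀ X Y : Set Γ, α (X ∪ Y) + α (X ∩ Y) ≤ α X + α Y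
  mono : ∀ X Y : Set Γ, X ⊆ Y → α X ≤ α Y
  conj : ∀ (X : Set Γ) (γ : Γ), α ((fun x => γ * x * γ⁻¹) '' X) = α X
  clos : ∀ X : Set Γ, α ((Subgroup.closure X : Subgroup Γ) : Set Γ) = α X

/-- A polymatroidal function is normalized if `α({g}) ≠ 0` for every non-identity `g`
and `α({1}) = 0`. -/
def Normalized [Group Γ] (α : Set Γ → ℤ) : Prop :=
  (∀ g : Γ, g ≠ 1 → α {g} ≠ 0) ∧ α ({1} : Set Γ) = 0

/-- The smoothness condition: `α(S ∪ {g}) - α(S) > k` implies `S = {1}` and `g² ≠ 1`. -/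
def Smooth [Group Γ] (α : Set Γ → ℤ) (k : ℤ) : Prop :=
  ∀ (S : Set Γ) (g : Γ), S.Nonempty → k < α (S ∪ {g}) - α S →
    S = ({1} : Set Γ) ∧ g ^ 2 ≠ 1


namespace GainGraph

section Walks

variable [Group Γ] {G : GainGraph V E Γ} {F F' : Set E}

theorem GainWalk.trans {u w x : V} {g g' : Γ} (hu : G.GainWalk F u w g)
    (hw : G.GainWalk F w x g') : G.GainWalk F u x (g * g') := by
  induction hw with
  | nil => simpa using hu
  | fwd _ he ht ih => rw [← mul_assoc]; exact ih.fwd he ht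
  | bwd _ he ht ih => rw [← mul_assoc]; exact ih.bwd he ht

theorem GainWalk.reverse {u w : V} {g : Γ} (hu : G.GainWalk F u w g) :
    G.GainWalk F w u g⁻¹ := by
  induction hu with
  | nil => simpa using GainWalk.nil
  | fwd _ he ht ih =>
    subst ht
    simpa using (GainWalk.nil.bwd he rfl).trans ih
  | bwd _ he ht ih =>
    subst ht
    simpa using (GainWalk.nil.fwd he rfl).trans ih

theorem GainWalk.mono (hF : F ⊆ F') {u w : V} {g : Γ} (hu : G.GainWalk F u w g) :
    G.GainWalk F' u w g := by
  induction hu with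
  | nil => exact .nil
  | fwd _ he ht ih => exact ih.fwd (hF he) ht
  | bwd _ he ht ih => exact ih.bwd (hF he) ht

theorem Balanced.mono (hF : F ⊆ F') (hb : G.Balanced F') : G.Balanced F :=
  fun v g hw => hb v g (hw.mono hF)

/-- Along a walk, a potential changes by the gain of the walk. -/
theorem GainWalk.potential_eq {p : V → Γ}
    (hp : ∀ e ∈ F, p (G.head e) = p (G.tail e) * G.gain e) {u w : V} {g : Γ}
    (hu : G.GainWalk F u w g) : p w = p u * g := by
  induction hu with
  | nil => simp
  | fwd _ he ht ih => rw [hp _ he, ht, ih, mul_assoc]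
  | bwd _ he ht ih => rw [← mul_assoc, ← ih, ← ht, hp _ he, mul_inv_cancel_right]

theorem balanced_of_potential {p : V → Γ}
    (hp : ∀ e ∈ F, p (G.head e) = p (G.tail e) * G.gain e) : G.Balanced F := by
  intro v g hw
  simpa using hw.potential_eq hp

/-- A balanced edge set has a potential. -/
theorem Balanced.exists_potential (hb : G.Balanced F) :
    ∃ p : V → Γ, ∀ e ∈ F, p (G.head e) = p (G.tail e) * G.gain e := by
  let s : Setoid V :=
    { r := fun u w => ∃ g, G.GainWalk F u w g
      iseqv :=
        { refl := fun _ => ⟨1, .nil⟩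
          symm := fun ⟨g, hg⟩ => ⟨g⁻¹, hg.reverse⟩
          trans := fun ⟨g, hg⟩ ⟨g', hg'⟩ => ⟨g * g', hg.trans hg'⟩ } }
  have hout : ∀ w : V, ∃ g, G.GainWalk F (Quotient.mk s w).out w g :=
    fun w => Quotient.exact (s := s) (Quotient.out_eq _)
  choose p hp using hout
  refine ⟨p, fun e he => ?_⟩
  have hq : Quotient.mk s (G.head e) = Quotient.mk s (G.tail e) :=
    Quotient.sound ⟨_, GainWalk.nil.bwd he rfl⟩
  have hw := hp (G.head e)
  rw [hq] at hw
  have := hb _ _ (((hp (G.tail e)).fwd he rfl).trans hw.reverse)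
  exact (mul_inv_eq_one.mp this).symm

theorem connected_of_root [DecidableEq V] {F : Finset E} (hF : F.Nonempty) (v : V)
    (h : ∀ u ∈ G.verts F, ∃ g, G.GainWalk (↑F) v u g) : G.Connected F := by
  refine ⟨hF, fun u hu w hw => ?_⟩
  obtain ⟨g, hg⟩ := h u hu
  obtain ⟨g', hg'⟩ := h w hw
  exact ⟨_, hg.reverse.trans hg'⟩

end Walks

section Beta

variable [Group Γ] {G : GainGraph V E Γ} {F : Finset E} {α : Set Γ → ℤ} {k : ℤ}

theorem alphaTilde_nonpos_of_balanced (hpoly : Polymatroidal α) (hnorm : Normalized α)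
    (hb : G.Balanced (↑F)) : alphaTilde α G F ≤ 0 := by
  unfold alphaTilde
  split_ifs
  · rw [← hnorm.2]
    exact hpoly.mono _ _ fun g hg => hb _ g hg
  · exact le_rfl

theorem beta_nonpos_of_balanced [DecidableEq V] (hpoly : Polymatroidal α) (hnorm : Normalized α)
    (hb : G.Balanced (↑F)) : beta α k G F ≤ 0 := by
  rw [beta, if_neg fun h => h.1 hb]
  exact alphaTilde_nonpos_of_balanced hpoly hnorm hb

theorem beta_le_of_isSplitBase [DecidableEq V] (hpoly : Polymatroidal α) (hnorm : Normalized α)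
    (hk : 0 ≤ k) {v : V} {B : Set E} (hB : G.IsSplitBase F v B) : beta α k G F ≤ k := by
  by_cases hb : G.Balanced (↑F)
  · exact (beta_nonpos_of_balanced hpoly hnorm hb).trans hk
  · rw [beta, if_pos ⟨hb, v, B, hB⟩]
    exact min_le_right _ _

end Beta

section SplitPotential

variable [Group Γ] {G : GainGraph V E Γ} {v : V} {B : Set E} {p : V → Γ} {h : Γ}

/-- A potential of the split at `v` with part `B`, with value `1` at `v₁` and `h` at `v₂`. -/
structure SplitPotential (G : GainGraph V E Γ) (v : V) (B : Set E) (p : V → Γ) (h : Γ) :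
    Prop where
  base : p v = 1
  avoid : ∀ e, G.tail e ≠ v → G.head e ≠ v → p (G.head e) = p (G.tail e) * G.gain e
  out : ∀ e, G.tail e = v → G.head e ≠ v → p (G.head e) = (if e ∈ B then h else 1) * G.gain e
  into : ∀ e, G.tail e ≠ v → G.head e = v → (if e ∈ B then h else 1) = p (G.tail e) * G.gain e
  loop : ∀ e, G.tail e = v → G.head e = v → G.gain e = 1 ∨ G.gain e = h

theorem IsSplitBase.exists_splitPotential [Fintype E]
    (hB : G.IsSplitBase (Finset.univ : Finset E) v B) : ∃ p h, G.SplitPotential v B p h := by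
  obtain ⟨P, hP⟩ := hB.2.exists_potential
  have hP' : ∀ e, P ((G.split v B).head e) = P ((G.split v B).tail e) * G.gain e :=
    fun e => hP e (by simp)
  refine ⟨fun w => (P (.inl v))⁻¹ * P (.inl w), (P (.inl v))⁻¹ * P (.inr ()), ?_, ?_, ?_, ?_, ?_⟩
  · simp
  · intro e ht hh
    have := hP' e
    simp only [split, ht, hh, false_and, if_false] at this
    rw [this, mul_assoc]
  · intro e ht hh
    have := hP' e
    by_cases he : e ∈ B <;> simp [split, ht, hh, he] at this <;> simp [he, this, mul_assoc]
  · intro e ht hh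
    have := hP' e
    by_cases he : e ∈ B <;> simp [split, ht, hh, he] at this <;> simp [he, this, mul_assoc]
  · intro e ht hh
    have := hP' e
    by_cases he : G.gain e = 1
    · exact .inl he
    · right
      simp only [split, ht, hh, he, and_self, if_true, if_false] at this
      rw [this, inv_mul_cancel_left]

theorem SplitPotential.edge (hp : G.SplitPotential v B p h) (e : E) :
    ∃ n : ℤ, p (G.head e) = h ^ n * p (G.tail e) * G.gain e := by
  by_cases ht : G.tail e = v <;> by_cases hh : G.head e = v
  · rw [ht, hh, hp.base]
    rcases hp.loop e ht hh with he | he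
    · exact ⟨0, by simp [he]⟩
    · exact ⟨-1, by simp [he]⟩
  · rw [hp.out e ht hh, ht, hp.base]
    split_ifs
    · exact ⟨1, by simp⟩
    · exact ⟨0, by simp⟩
  · have := hp.into e ht hh
    rw [hh, hp.base]
    split_ifs at this
    · exact ⟨-1, by simp [mul_assoc, ← this]⟩
    · exact ⟨0, by simp [← this]⟩
  · exact ⟨0, by simp [hp.avoid e ht hh]⟩

theorem SplitPotential.walk (hp : G.SplitPotential v B p h) {F : Set E} {u w : V} {g : Γ}
    (hw : G.GainWalk F u w g) : ∃ n : ℤ, p w = h ^ n * p u * g := by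
  induction hw with
  | nil => exact ⟨0, by simp⟩
  | @fwd w g e _ _ ht ih =>
    obtain ⟨n, hn⟩ := ih
    obtain ⟨m, hm⟩ := hp.edge e
    exact ⟨m + n, by rw [hm, ht, hn, zpow_add]; simp only [mul_assoc]⟩
  | @bwd w g e _ _ ht ih =>
    obtain ⟨n, hn⟩ := ih
    obtain ⟨m, hm⟩ := hp.edge e
    rw [ht, hn] at hm
    refine ⟨-m + n, ?_⟩
    rw [zpow_add, zpow_neg, ← mul_assoc, mul_assoc _ (h ^ n), mul_assoc _ (h ^ n * p u), hm]
    group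

theorem SplitPotential.alphaTilde_le (hp : G.SplitPotential v B p h) {α : Set Γ → ℤ}
    (hpoly : Polymatroidal α) {F : Finset E} (hF : F.Nonempty) : alphaTilde α G F ≤ α {h} := by
  rw [alphaTilde, dif_pos hF, ← hpoly.clos {h},
    ← hpoly.conj (Subgroup.closure {h} : Set Γ) (p (G.tail hF.choose))⁻¹]
  refine hpoly.mono _ _ fun g hg => ?_
  obtain ⟨n, hn⟩ := hp.walk hg
  refine ⟨h ^ (-n), (Subgroup.closure {h}).zpow_mem (Subgroup.subset_closure rfl) _, ?_⟩
  have : g = (h ^ n * p (G.tail hF.choose))⁻¹ * p (G.tail hF.choose) := by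
    rw [eq_inv_mul_iff_mul_eq, ← hn]
  rw [this]
  group

theorem SplitPotential.sq_ne_one [Fintype E] [DecidableEq V] (hp : G.SplitPotential v B p h)
    {α : Set Γ → ℤ} {k : ℤ} (hpoly : Polymatroidal α) (hnorm : Normalized α) (hsmooth : Smooth α k)
    (hcrit : AlphaCritical α k G Finset.univ) : h ^ 2 ≠ 1 := by
  refine (hsmooth {1} h ⟨1, rfl⟩ ?_).2
  have h₁ := hcrit.2.2.trans_le (hp.alphaTilde_le hpoly hcrit.1.1)
  have h₂ := hpoly.mono {h} ({1} ∪ {h}) Set.subset_union_right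
  have h₃ := hnorm.2
  omega

/-- The edges meeting a part of `G - v` all of whose edges to `v` lie on one side of a balanced
split form a balanced set. -/
theorem SplitPotential.balanced_of_side (hp : G.SplitPotential v B p h) {F : Set E} (s : Prop)
    (hloop : ∀ e ∈ F, ¬ (G.tail e = v ∧ G.head e = v))
    (hside : ∀ e ∈ F, e ∈ G.nonloopAt v → (e ∈ B ↔ s)) : G.Balanced F := by
  refine balanced_of_potential (p := Function.update p v (if s then h else 1)) fun e he => ?_
  have hs := hside e he
  by_cases ht : G.tail e = v <;> by_cases hh : G.head e = v
  · exact absurd ⟨ht, hh⟩ (hloop e he)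
  · have hs := hs ⟨.inl ht, fun h => hh (h ▸ ht)⟩
    simp only [Function.update_of_ne hh, ht, Function.update_self, hp.out e ht hh, hs]
  · have hs := hs ⟨.inr hh, fun h => ht (h.trans hh)⟩
    simp only [Function.update_of_ne ht, hh, Function.update_self, ← hp.into e ht hh, hs]
  · simp only [Function.update_of_ne hh, Function.update_of_ne ht, hp.avoid e ht hh]

end SplitPotential

section Counting

variable [Group Γ] {G : GainGraph V E Γ} {v : V} {α : Set Γ → ℤ} {k ℓ : ℤ}

/-- If `C` is a union of components of `G - v`, a walk starting at `v` can be shortened to one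
that uses either only edges meeting `C` or only edges avoiding `C`. -/
theorem GainWalk.restrict {C : Set V} (hv : v ∉ C)
    (hC : ∀ e, G.tail e ≠ v → G.head e ≠ v → (G.tail e ∈ C ↔ G.head e ∈ C))
    {F : Set E} {w : V} {g : Γ} (hw : G.GainWalk F v w g) :
    (w ∈ C → ∃ g', G.GainWalk {e ∈ F | G.tail e ∈ C ∨ G.head e ∈ C} v w g') ∧
    (w ∉ C → ∃ g', G.GainWalk {e ∈ F | ¬ (G.tail e ∈ C ∨ G.head e ∈ C)} v w g') := by
  have hne : ∀ {x}, x ∈ C → x ≠ v := fun hx h => hv (h ▸ hx)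
  induction hw with
  | nil => exact ⟨fun h => absurd h hv, fun _ => ⟨1, .nil⟩⟩
  | @fwd w g e _ he ht ih =>
    subst ht
    constructor <;> intro hh
    · by_cases h : G.tail e ∈ C
      · obtain ⟨g', hg'⟩ := ih.1 h
        exact ⟨_, hg'.fwd ⟨he, .inl h⟩ rfl⟩
      · have htv : G.tail e = v := by
          by_contra htv
          exact h ((hC e htv (hne hh)).2 hh)
        exact ⟨_, GainWalk.nil.fwd ⟨he, .inr hh⟩ htv⟩
    · by_cases h : G.tail e ∈ C
      · have hhv : G.head e = v := by
          by_contra hhv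
          exact hh ((hC e (hne h) hhv).1 h)
        exact hhv ▸ ⟨1, .nil⟩
      · obtain ⟨g', hg'⟩ := ih.2 h
        exact ⟨_, hg'.fwd ⟨he, by tauto⟩ rfl⟩
  | @bwd w g e _ he ht ih =>
    subst ht
    constructor <;> intro hh
    · by_cases h : G.head e ∈ C
      · obtain ⟨g', hg'⟩ := ih.1 h
        exact ⟨_, hg'.bwd ⟨he, .inr h⟩ rfl⟩
      · have hhv : G.head e = v := by
          by_contra hhv
          exact h ((hC e (hne hh) hhv).1 hh)
        exact ⟨_, GainWalk.nil.bwd ⟨he, .inl hh⟩ hhv⟩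
    · by_cases h : G.head e ∈ C
      · have htv : G.tail e = v := by
          by_contra htv
          exact hh ((hC e htv (hne h)).2 h)
        exact htv ▸ ⟨1, .nil⟩
      · obtain ⟨g', hg'⟩ := ih.2 h
        exact ⟨_, hg'.bwd ⟨he, by tauto⟩ rfl⟩

/-- In an `α`-critical `f_α`-full graph with base `v`, the edges meeting a nonempty union of
components of `G - v` are unbalanced. -/
theorem not_balanced_of_full [Fintype V] [DecidableEq V] [Fintype E] (hk : 1 ≤ k)
    (hpoly : Polymatroidal α) (hnorm : Normalized α)
    (hrange : ∀ X : Set Γ, α X ≤ ℓ) (hcrit : AlphaCritical α k G Finset.univ)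
    (hfull : FullGraph α k ℓ G) {B : Set E} (hB : G.IsSplitBase Finset.univ v B)
    {C : Set V} (hv : v ∉ C) (hne : C.Nonempty)
    (hC : ∀ e, G.tail e ≠ v → G.head e ≠ v → (G.tail e ∈ C ↔ G.head e ∈ C)) :
    ¬ G.Balanced {e | G.tail e ∈ C ∨ G.head e ∈ C} := by
  intro hbal
  obtain ⟨E', hconn, hverts, hsparse, hbeta, hcard⟩ := hfull
  have hkl : k < ℓ := by
    have h₁ := hcrit.2.2
    rw [alphaTilde, dif_pos hcrit.1.1] at h₁
    exact h₁.trans_le (hrange _)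
  have hβ : beta α k G E' = k := by
    rw [hbeta, beta, if_pos hcrit.2.1, min_eq_right hcrit.2.2.le]
  set X := E'.filter fun e => G.tail e ∈ C ∨ G.head e ∈ C with hX
  set Y := E'.filter fun e => ¬ (G.tail e ∈ C ∨ G.head e ∈ C) with hY
  have hXc : (↑X : Set E) = {e ∈ (↑E' : Set E) | G.tail e ∈ C ∨ G.head e ∈ C} := by
    simp [hX]
  have hYc : (↑Y : Set E) = {e ∈ (↑E' : Set E) | ¬ (G.tail e ∈ C ∨ G.head e ∈ C)} := by
    simp only [hY, Finset.coe_filter, Finset.mem_coe]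
  have hXbal : G.Balanced (↑X) := hbal.mono (by rw [hXc]; exact fun e he => he.2)
  have hXY : X.card + Y.card = E'.card := Finset.card_filter_add_card_filter_not _
  have hwalk : ∀ w, ∃ g, G.GainWalk (↑E') v w g := fun w =>
    hconn.2 v (by simp [hverts]) w (by simp [hverts])
  have hXv : ∀ u ∈ G.verts X, u = v ∨ u ∈ C := by
    intro u hu
    by_contra! hu'
    simp only [verts, Finset.mem_union, Finset.mem_image] at hu
    rcases hu with ⟨e, he, rfl⟩ | ⟨e, he, rfl⟩
    · have he := (Finset.mem_filter.mp he).2.resolve_left hu'.2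
      exact hu'.2 ((hC e hu'.1 fun h => hv (h ▸ he)).2 he)
    · have he := (Finset.mem_filter.mp he).2.resolve_right hu'.2
      exact hu'.2 ((hC e (fun h => hv (h ▸ he)) hu'.1).1 he)
  have hYv : ∀ u ∈ G.verts Y, u ∉ C := by
    intro u hu
    simp only [verts, Finset.mem_union, Finset.mem_image] at hu
    rcases hu with ⟨e, he, rfl⟩ | ⟨e, he, rfl⟩ <;>
      have he := (Finset.mem_filter.mp he).2 <;> tauto
  have hXne : X.Nonempty := by
    obtain ⟨c, hc⟩ := hne
    have hc' : c ∈ G.verts E' := by simp [hverts]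
    simp only [verts, Finset.mem_union, Finset.mem_image] at hc'
    rcases hc' with ⟨e, he, rfl⟩ | ⟨e, he, rfl⟩
    · exact ⟨e, Finset.mem_filter.mpr ⟨he, .inl hc⟩⟩
    · exact ⟨e, Finset.mem_filter.mpr ⟨he, .inr hc⟩⟩
  have hYne : Y.Nonempty := by
    by_contra hYe
    have hXE : X = E' := Finset.filter_true_of_mem fun e he => by
      by_contra h
      exact hYe ⟨e, Finset.mem_filter.mpr ⟨he, h⟩⟩
    have := beta_nonpos_of_balanced (k := k) hpoly hnorm (hXE ▸ hXbal)
    omega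
  have hXconn : G.Connected X := connected_of_root hXne v fun u hu => by
    rcases hXv u hu with rfl | hu
    · exact ⟨1, .nil⟩
    · obtain ⟨g, hg⟩ := hwalk u
      rw [hXc]
      exact (hg.restrict hv hC).1 hu
  have hYconn : G.Connected Y := connected_of_root hYne v fun u hu => by
    obtain ⟨g, hg⟩ := hwalk u
    rw [hYc]
    exact (hg.restrict hv hC).2 (hYv u hu)
  have hXs := hsparse X (Finset.filter_subset _ _) hXconn
  have hYs := hsparse Y (Finset.filter_subset _ _) hYconn
  have hXβ := beta_nonpos_of_balanced (k := k) hpoly hnorm hXbal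
  have hYβ := beta_le_of_isSplitBase (F := Y) (k := k) hpoly hnorm (by omega)
    ⟨hB.1, hB.2.mono (by simp)⟩
  have hV : (G.verts X).card + (G.verts Y).card ≤ Fintype.card V + 1 := by
    have hi : G.verts X ∩ G.verts Y ⊆ {v} := fun u hu => by
      rw [Finset.mem_inter] at hu
      exact Finset.mem_singleton.mpr ((hXv u hu.1).resolve_right (hYv u hu.2))
    have := Finset.card_union_add_card_inter (G.verts X) (G.verts Y)
    have := Finset.card_le_card hi
    have := Finset.card_le_univ (G.verts X ∪ G.verts Y)
    simp only [Finset.card_singleton] at *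
    omega
  have hV' : k * ((G.verts X).card : ℤ) + k * ((G.verts Y).card : ℤ)
      ≤ k * (Fintype.card V : ℤ) + k := by
    have : ((G.verts X).card : ℤ) + (G.verts Y).card ≤ Fintype.card V + 1 := by exact_mod_cast hV
    nlinarith
  rw [fAlpha] at hXs hYs
  rw [hβ, hverts, Finset.card_univ, min_eq_right (by omega)] at hcard
  omega

end Counting

section Extra

variable {G : GainGraph V E Γ} {v : V}

/-- The end of an edge at `v` other than `v`. -/
noncomputable def farEnd (G : GainGraph V E Γ) (v : V) (e : E) : V :=
  if G.tail e = v then G.head e else G.tail e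

theorem farEnd_ne {e : E} (he : e ∈ G.nonloopAt v) : G.farEnd v e ≠ v := by
  unfold farEnd
  split_ifs with h
  · exact fun h' => he.2 (h.trans h'.symm)
  · exact h

variable [Group Γ]

/-- Comparison of the potentials of two balanced splits across an edge at `v`. -/
theorem SplitPotential.ratio_eq {B₁ B₂ : Set E} {p₁ p₂ : V → Γ} {h₁ h₂ : Γ}
    (hp₁ : G.SplitPotential v B₁ p₁ h₁) (hp₂ : G.SplitPotential v B₂ p₂ h₂) {e : E}
    (he : e ∈ G.nonloopAt v) :
    p₂ (G.farEnd v e) * (p₁ (G.farEnd v e))⁻¹ =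
      (if e ∈ B₂ then h₂ else 1) * (if e ∈ B₁ then h₁ else 1)⁻¹ := by
  by_cases ht : G.tail e = v
  · have hh : G.head e ≠ v := fun h => he.2 (ht.trans h.symm)
    rw [farEnd, if_pos ht, hp₁.out e ht hh, hp₂.out e ht hh]
    group
  · have hh : G.head e = v := he.1.resolve_left ht
    rw [farEnd, if_neg ht, hp₁.into e ht hh, hp₂.into e ht hh]
    group

/-- Two balanced splits at the base of an `α`-critical `f_α`-full graph have the same
bipartition. -/
theorem IsSplitBase.eq_or_compl [Fintype V] [DecidableEq V] [Fintype E] {α : Set Γ → ℤ} {k ℓ : ℤ}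
    (hk : 1 ≤ k) (hpoly : Polymatroidal α) (hnorm : Normalized α) (hrange : ∀ X : Set Γ, α X ≤ ℓ)
    (hsmooth : Smooth α k) (hcrit : AlphaCritical α k G Finset.univ) (hfull : FullGraph α k ℓ G)
    {B₁ B₂ : Set E} (hB₁ : G.IsSplitBase Finset.univ v B₁)
    (hB₂ : G.IsSplitBase Finset.univ v B₂) :
    (∀ e ∈ G.nonloopAt v, e ∈ B₁ ↔ e ∈ B₂) ∨ (∀ e ∈ G.nonloopAt v, e ∈ B₁ ↔ e ∉ B₂) := by
  obtain ⟨p₁, h₁, hp₁⟩ := hB₁.exists_splitPotential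
  obtain ⟨p₂, h₂, hp₂⟩ := hB₂.exists_splitPotential
  have hsq₁ := hp₁.sq_ne_one hpoly hnorm hsmooth hcrit
  have hone₁ : h₁ ≠ 1 := fun h => hsq₁ (by simp [h])
  let q : V → Γ := fun w => p₂ w * (p₁ w)⁻¹
  have hother : ∀ e ∈ G.nonloopAt v, ∃ e' ∈ G.nonloopAt v,
      q (G.farEnd v e') = q (G.farEnd v e) ∧ ¬ (e' ∈ B₁ ↔ e ∈ B₁) := by
    intro e he
    by_contra! hmono
    refine not_balanced_of_full hk hpoly hnorm hrange hcrit hfull hB₁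
      (C := {w | w ≠ v ∧ q w = q (G.farEnd v e)}) (by simp)
      ⟨G.farEnd v e, farEnd_ne he, rfl⟩ ?_ ?_
    · intro e' ht hh
      have : q (G.head e') = q (G.tail e') := by
        simp only [q, hp₁.avoid e' ht hh, hp₂.avoid e' ht hh]
        group
      simp [ht, hh, this]
    · refine hp₁.balanced_of_side (e ∈ B₁) ?_ ?_
      · rintro e' (h | h) ⟨ht, hh⟩
        · exact h.1 ht
        · exact h.1 hh
      · intro e' he' hn
        refine hmono e' hn ?_
        by_cases ht : G.tail e' = v
        · rw [farEnd, if_pos ht]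
          exact (he'.resolve_left fun h => h.1 ht).2
        · rw [farEnd, if_neg ht]
          exact (he'.resolve_right fun h => h.1 (hn.1.resolve_left ht)).2
  have hedge : ∀ e ∈ G.nonloopAt v,
      ((e ∈ B₁ ↔ e ∈ B₂) ∧ h₂ = h₁) ∨ ((e ∈ B₁ ↔ e ∉ B₂) ∧ h₂ = h₁⁻¹) := by
    intro e he
    obtain ⟨e', he', hq, hside⟩ := hother e he
    simp only [q, hp₁.ratio_eq hp₂ he, hp₁.ratio_eq hp₂ he'] at hq
    by_cases a : e ∈ B₁ <;> by_cases b : e ∈ B₂ <;> by_cases a' : e' ∈ B₁ <;>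
      by_cases b' : e' ∈ B₂ <;> simp_all [mul_inv_eq_iff_eq_mul, eq_comm]
  by_cases hh : h₂ = h₁
  · left
    intro e he
    refine ((hedge e he).resolve_right fun h => hsq₁ ?_).1
    rw [sq, mul_eq_one_iff_eq_inv, ← h.2, hh]
  · exact .inr fun e he => ((hedge e he).resolve_left fun h => hh h.2).1

end Extra

end GainGraph

/-- Lemma 4: if `(G,ψ)` is `α`-critical and `f_α`-full with base `v`,
and `E₁ ≠ E₂` are two extra edge sets for the near-balancedness, then
`{E₁ ∖ L_v, E₂ ∖ L_v}` is a partition of `E_v ∖ L_v`. -/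
theorem statement12 {V E Γ : Type} [Fintype V] [DecidableEq V] [Fintype E] [DecidableEq E]
    [Group Γ] (k ℓ : ℤ) (hk : 1 ≤ k) (hl0 : 0 ≤ ℓ) (hl : ℓ ≤ 2 * k - 1)
    (α : Set Γ → ℤ) (hpoly : Polymatroidal α) (hnorm : Normalized α)
    (hrange : ∀ X : Set Γ, 0 ≤ α X ∧ α X ≤ ℓ) (hsmooth : Smooth α k)
    (G : GainGraph V E Γ)
    (hcrit : GainGraph.AlphaCritical α k G (Finset.univ : Finset E))
    (hfull : GainGraph.FullGraph α k ℓ G)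
    (v : V) (hbase : ∃ B : Set E, G.IsSplitBase Finset.univ v B)
    (E₁ E₂ : Set E)
    (hE₁ : G.ExtraEdgeSet Finset.univ v E₁)
    (hE₂ : G.ExtraEdgeSet Finset.univ v E₂)
    (hne : E₁ ≠ E₂) :
    Disjoint (E₁ \ G.loopsAt v) (E₂ \ G.loopsAt v) ∧
    (E₁ \ G.loopsAt v) ∪ (E₂ \ G.loopsAt v) = G.incidentAt v \ G.loopsAt v := by
  obtain ⟨B₁, hB₁, hK₁⟩ := hE₁
  obtain ⟨B₂, hB₂, hK₂⟩ := hE₂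
  have key := hB₁.eq_or_compl hk hpoly hnorm (fun X => (hrange X).2) hsmooth hcrit hfull hB₂
  have hN : G.nonloopAt v = G.incidentAt v \ G.loopsAt v := by
    ext e
    simp only [GainGraph.nonloopAt, GainGraph.incidentAt, GainGraph.loopsAt, Set.mem_ofPred_eq,
      Set.mem_sdiff]
    grind
  have hU : G.unbalancedLoopsAt v ⊆ G.loopsAt v := fun e he => ⟨he.1, he.2.1⟩
  have hloop : ∀ K ⊆ G.nonloopAt v, (K ∪ G.unbalancedLoopsAt v) \ G.loopsAt v = K := by
    intro K hK
    rw [Set.union_sdiff_distrib, Set.sdiff_eq_empty.mpr hU, Set.union_empty]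
    exact sdiff_eq_left.mpr (Set.disjoint_left.mpr fun e he => (hN ▸ hK he).2)
  have hpart : ∀ {K B : Set E}, B ⊆ G.nonloopAt v →
      (K = B ∪ G.unbalancedLoopsAt v ∨ K = (G.nonloopAt v \ B) ∪ G.unbalancedLoopsAt v) →
      ∃ K' ⊆ G.nonloopAt v, K = K' ∪ G.unbalancedLoopsAt v ∧
        ((∀ e ∈ G.nonloopAt v, e ∈ K' ↔ e ∈ B) ∨ (∀ e ∈ G.nonloopAt v, e ∈ K' ↔ e ∉ B)) := by
    rintro K B hB (h | h)
    · exact ⟨B, hB, h, .inl fun _ _ => Iff.rfl⟩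
    · exact ⟨_, Set.sdiff_subset, h, .inr fun e he => by simp [he]⟩
  obtain ⟨K₁, h₁, rfl, hs₁⟩ := hpart hB₁.1 hK₁
  obtain ⟨K₂, h₂, rfl, hs₂⟩ := hpart hB₂.1 hK₂
  have hs : (∀ e ∈ G.nonloopAt v, e ∈ K₁ ↔ e ∈ K₂) ∨ (∀ e ∈ G.nonloopAt v, e ∈ K₁ ↔ e ∉ K₂) := by
    rcases key with key | key <;> rcases hs₁ with hs₁ | hs₁ <;> rcases hs₂ with hs₂ | hs₂
    all_goals first
      | (refine .inl fun e he => ?_; simp [key e he, hs₁ e he, hs₂ e he]; done)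
      | (refine .inr fun e he => ?_; simp [key e he, hs₁ e he, hs₂ e he])
  have h := hs.resolve_left fun h => hne (congrArg (· ∪ _) (Set.ext fun e =>
    ⟨fun he => (h e (h₁ he)).1 he, fun he => (h e (h₂ he)).2 he⟩))
  rw [hloop K₁ h₁, hloop K₂ h₂, ← hN, Set.disjoint_left]
  refine ⟨fun e he => (h e (h₁ he)).1 he, Set.Subset.antisymm (Set.union_subset h₁ h₂) ?_⟩
  intro e he
  by_cases hK : e ∈ K₂
  · exact .inr hK
  · exact .inl ((h e he).2 hK)

end CountMatroidPaper
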